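/- arXiv:2407.11313 — 2 statements merged into one kernel-verified Lean document; each statement's English description precedes it below -/
import Mathlib

section
/- The sequence {a_{2k}/(2k)!}_{k≥0} is strictly log-concave, where a_{2k} is the 2k-th Euler zigzag number (the number of alternating permutations of length 2k); that is, (a_{2k}/(2k)!)² > (a_{2k-2}/(2k-2)!)·(a_{2k+2}/(2k+2)!) for all k ≥ 1. -/
/-- The restriction of a collection of finsets to subsets of `I`. -/
def BS.restrict (B : Finset (Finset ℕ)) (I : Finset ℕ) : Finset (Finset ℕ) :=
  B.filter (· ⊆ I)

/-- `B` is a building set on `S`. -/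
def BS.IsBuilding (S : Finset ℕ) (B : Finset (Finset ℕ)) : Prop :=
  (∀ J ∈ B, J ⊆ S ∧ J.Nonempty) ∧
  (∀ i ∈ S, ({i} : Finset ℕ) ∈ B) ∧
  (∀ I ∈ B, ∀ J ∈ B, (I ∩ J).Nonempty → I ∪ J ∈ B)

/-- `B` is chordal: every "suffix" `{x ∈ I : a ≤ x}` of an element `I` is in `B`. -/
def BS.IsChordal (B : Finset (Finset ℕ)) : Prop :=
  ∀ I ∈ B, ∀ a ∈ I, I.filter (fun x => a ≤ x) ∈ B

/-- A connected component of `B`: an inclusion-maximal element. -/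
def BS.IsComponent (B : Finset (Finset ℕ)) (C : Finset ℕ) : Prop :=
  C ∈ B ∧ ∀ J ∈ B, C ⊆ J → J = C

/-- The restriction of `B` to `I` has no connected component of odd cardinality. -/
def BS.NoOddComp (B : Finset (Finset ℕ)) (I : Finset ℕ) : Prop :=
  ∀ C ∈ BS.restrict B I, BS.IsComponent (BS.restrict B I) C → Even C.card

/-- The poset `P̂_B` of subsets of `S` whose restriction has no odd component. -/
def BS.hatP (B : Finset (Finset ℕ)) (S : Finset ℕ) : Set (Finset ℕ) :=
  {I | I ⊆ S ∧ BS.NoOddComp B I}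

/-- `L` is a (one-line notation) permutation of the finite set `S`. -/
def BS.IsPermOf (S : Finset ℕ) (L : List ℕ) : Prop :=
  L.Nodup ∧ L.toFinset = S

/-- `L` is a `B`-permutation: each entry lies in the same connected component of the
restriction of `B` to the prefix as the maximum of the prefix. -/
def BS.IsBPerm (B : Finset (Finset ℕ)) (S : Finset ℕ) (L : List ℕ) : Prop :=
  BS.IsPermOf S L ∧
  ∀ i, i < L.length →
    ∃ C : Finset ℕ, BS.IsComponent (BS.restrict B (L.take (i + 1)).toFinset) C ∧
      L.getD i 0 ∈ C ∧ ∃ M ∈ C, ∀ y ∈ (L.take (i + 1)).toFinset, y ≤ M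

/-- `L` is alternating: `x₁ > x₂ < x₃ > x₄ < ⋯`. -/
def BS.IsAlternating (L : List ℕ) : Prop :=
  ∀ i, i + 1 < L.length →
    (i % 2 = 0 → L.getD (i + 1) 0 < L.getD i 0) ∧
    (i % 2 = 1 → L.getD i 0 < L.getD (i + 1) 0)

/-- The Euler zigzag number `a_m`: the number of alternating permutations
`x₁ > x₂ < x₃ > ⋯` of `{1,…,m}`. -/
noncomputable def zigzag (m : ℕ) : ℕ :=
  Set.ncard {L : List ℕ | BS.IsPermOf (Finset.Icc 1 m) L ∧ BS.IsAlternating L}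

/-- `L` alternates between the relation `r` and its reverse, starting with `r`. -/
def AlternatesFrom : (ℕ → ℕ → Prop) → List ℕ → Prop
  | _, [] => True
  | _, [_] => True
  | r, x :: y :: l => r x y ∧ AlternatesFrom (flip r) (y :: l)

theorem forall_getD_iff_alternatesFrom (L : List ℕ) (r : ℕ → ℕ → Prop) :
    (∀ i, i + 1 < L.length →
      (i % 2 = 0 → r (L.getD i 0) (L.getD (i + 1) 0)) ∧
      (i % 2 = 1 → r (L.getD (i + 1) 0) (L.getD i 0))) ↔ AlternatesFrom r L := by
  induction L generalizing r with
  | nil => simp [AlternatesFrom]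
  | cons x l ih =>
    cases l with
    | nil => simp [AlternatesFrom]
    | cons y l =>
      rw [AlternatesFrom, ← ih (flip r)]
      constructor
      · intro h
        refine ⟨by simpa using (h 0 (by simp)).1, fun i hi => ?_⟩
        have := h (i + 1) (by simpa using hi)
        refine ⟨fun h2 => ?_, fun h2 => ?_⟩
        · simpa [flip] using this.2 (by omega)
        · simpa [flip] using this.1 (by omega)
      · rintro ⟨h0, h⟩ i hi
        cases i with
        | zero => simpa using h0
        | succ i =>
          have := h i (by simpa using hi)
          refine ⟨fun h2 => ?_, fun h2 => ?_⟩
          · simpa [flip] using this.2 (by omega)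
          · simpa [flip] using this.1 (by omega)

/-- The Entringer numbers: `entringer m k` counts the alternating permutations of `m + 1` letters
whose first letter has exactly `k` smaller ones. -/
def entringer : ℕ → ℕ → ℕ
  | 0, _ => 1
  | m + 1, k => ∑ i ∈ Finset.range k, entringer m (m - i)

open Classical in
/-- In a finite set, summing over the elements is summing over their ranks. -/
theorem sum_rank_eq_sum_range (r : ℕ → ℕ → Prop) [IsStrictTotalOrder ℕ r] (T : Finset ℕ)
    (g : ℕ → ℕ) :
    ∑ y ∈ T, g (T.filter (r y)).card = ∑ i ∈ Finset.range T.card, g i := by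
  have hlt : ∀ y ∈ T, ∀ z ∈ T, r y z → (T.filter (r z)).card < (T.filter (r y)).card := by
    intro y _ z hz hyz
    apply Finset.card_lt_card
    refine ⟨fun w hw => ?_, fun h => ?_⟩
    · simp only [Finset.mem_filter] at hw ⊢
      exact ⟨hw.1, _root_.trans hyz hw.2⟩
    · have := h (Finset.mem_filter.2 ⟨hz, hyz⟩)
      exact irrefl z (Finset.mem_filter.1 this).2
  have hinj : Set.InjOn (fun y => (T.filter (r y)).card) T := by
    intro y hy z hz h
    rcases trichotomous_of r y z with h1 | h1 | h1
    · exact absurd h (hlt y hy z hz h1).ne'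
    · exact h1
    · exact absurd h (hlt z hz y hy h1).ne
  have himg : T.image (fun y => (T.filter (r y)).card) = Finset.range T.card := by
    apply Finset.eq_of_subset_of_card_le
    · intro i hi
      obtain ⟨y, hy, rfl⟩ := Finset.mem_image.1 hi
      refine Finset.mem_range.2 (Finset.card_lt_card ⟨Finset.filter_subset _ _, fun h => ?_⟩)
      exact irrefl y (Finset.mem_filter.1 (h hy)).2
    · rw [Finset.card_image_of_injOn hinj, Finset.card_range]
  rw [← himg, Finset.sum_image hinj]

theorem BS.isPermOf_cons {S : Finset ℕ} {x : ℕ} {L : List ℕ} (hx : x ∈ S) :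
    BS.IsPermOf S (x :: L) ↔ BS.IsPermOf (S.erase x) L := by
  unfold BS.IsPermOf
  simp only [List.nodup_cons, List.toFinset_cons]
  constructor
  · rintro ⟨⟨h1, h2⟩, rfl⟩
    exact ⟨h2, by rw [Finset.erase_insert (by simpa using h1)]⟩
  · rintro ⟨h1, h2⟩
    refine ⟨⟨fun h => ?_, h1⟩, by rw [h2, Finset.insert_erase hx]⟩
    have : x ∈ S.erase x := h2 ▸ List.mem_toFinset.2 h
    simp at this

open Classical in
theorem exists_card_eq_entringer (m : ℕ) (r : ℕ → ℕ → Prop) [IsStrictTotalOrder ℕ r]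
    (S : Finset ℕ) (hS : S.card = m + 1) (x : ℕ) (hx : x ∈ S) :
    ∃ F : Finset (List ℕ),
      (∀ L, L ∈ F ↔ L.head? = some x ∧ BS.IsPermOf S L ∧ AlternatesFrom r L) ∧
      F.card = entringer m (S.filter (r x)).card := by
  induction m generalizing r S x with
  | zero =>
    obtain ⟨y, rfl⟩ := Finset.card_eq_one.1 hS
    obtain rfl : x = y := by simpa using hx
    refine ⟨{[x]}, fun L => ?_, by simp [entringer]⟩
    rw [Finset.mem_singleton]
    constructor
    · rintro rfl
      simp [BS.IsPermOf, AlternatesFrom]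
    · rintro ⟨h1, h2, -⟩
      obtain ⟨l, rfl⟩ := List.head?_eq_some_iff.1 h1
      rw [BS.isPermOf_cons hx] at h2
      have : l.toFinset = ∅ := by simpa using h2.2
      rw [(List.toFinset_eq_empty_iff _).1 this]
  | succ m ih =>
    have hflip : IsStrictTotalOrder ℕ (flip r) :=
      inferInstanceAs (IsStrictTotalOrder ℕ (Function.swap r))
    have hcard : (S.erase x).card = m + 1 := by rw [Finset.card_erase_of_mem hx]; omega
    choose! F hF hFc using fun y hy => ih (flip r) (S.erase x) hcard y hy
    set T := (S.erase x).filter (r x) with hT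
    have hTS : ∀ y ∈ T, y ∈ S.erase x := fun y hy => (Finset.mem_filter.1 hy).1
    refine ⟨(T.biUnion F).image (List.cons x), fun L => ?_, ?_⟩
    · simp only [Finset.mem_image, Finset.mem_biUnion]
      constructor
      · rintro ⟨l, ⟨y, hy, hl⟩, rfl⟩
        obtain ⟨h1, h2, h3⟩ := (hF y (hTS y hy) l).1 hl
        obtain ⟨l, rfl⟩ := List.head?_eq_some_iff.1 h1
        exact ⟨rfl, (BS.isPermOf_cons hx).2 h2, (Finset.mem_filter.1 hy).2, h3⟩
      · rintro ⟨h1, h2, h3⟩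
        obtain ⟨l, rfl⟩ := List.head?_eq_some_iff.1 h1
        rw [BS.isPermOf_cons hx] at h2
        refine ⟨l, ?_, rfl⟩
        cases l with
        | nil =>
          have : (S.erase x).card = 0 := by rw [← h2.2]; rfl
          omega
        | cons y l =>
          have hy : y ∈ S.erase x := by rw [← h2.2]; simp
          exact ⟨y, Finset.mem_filter.2 ⟨hy, h3.1⟩, (hF y hy _).2 ⟨rfl, h2, h3.2⟩⟩
    · rw [Finset.card_image_of_injective _ List.cons_injective, Finset.card_biUnion]
      · have hTx : S.filter (r x) = T := by
          ext z
          simp only [hT, Finset.mem_filter, Finset.mem_erase]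
          refine ⟨fun h => ⟨⟨?_, h.1⟩, h.2⟩, fun h => ⟨h.1.2, h.2⟩⟩
          rintro rfl
          exact irrefl z h.2
        rw [hTx, entringer, ← sum_rank_eq_sum_range r T fun i => entringer m (m - i)]
        refine Finset.sum_congr rfl fun y hy => ?_
        rw [hFc y (hTS y hy)]
        congr 1
        have h1 : T.filter (r y) = (S.erase x).filter (r y) := by
          ext z
          simp only [hT, Finset.mem_filter]
          exact ⟨fun h => ⟨h.1.1, h.2⟩,
            fun h => ⟨⟨h.1, _root_.trans (Finset.mem_filter.1 hy).2 h.2⟩, h.2⟩⟩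
        have h2 : (S.erase x).filter (fun z => ¬ r y z) =
            insert y ((S.erase x).filter (flip r y)) := by
          ext z
          simp only [Finset.mem_filter, Finset.mem_insert, flip]
          constructor
          · rintro ⟨hz, h⟩
            rcases trichotomous_of r y z with h' | h' | h'
            · exact absurd h' h
            · exact Or.inl h'.symm
            · exact Or.inr ⟨hz, h'⟩
          · rintro (rfl | ⟨hz, h⟩)
            · exact ⟨hTS _ hy, irrefl _⟩
            · exact ⟨hz, asymm h⟩
        have h3 := Finset.card_filter_add_card_filter_not (s := S.erase x) (r y)
        rw [h2, Finset.card_insert_of_notMem (by simp [flip, irrefl y]), hcard] at h3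
        rw [h1]
        omega
      · intro y hy z hz hyz
        refine Finset.disjoint_left.2 fun L h1 h2 => hyz ?_
        have e1 := ((hF y (hTS y hy) L).1 h1).1
        have e2 := ((hF z (hTS z hz) L).1 h2).1
        exact Option.some_injective _ (e1.symm.trans e2)

theorem zigzag_eq_entringer (m : ℕ) : zigzag m = entringer m m := by
  classical
  unfold zigzag BS.IsAlternating
  simp_rw [forall_getD_iff_alternatesFrom _ (fun a b => b < a)]
  cases m with
  | zero =>
    have : {L : List ℕ | BS.IsPermOf (Finset.Icc 1 0) L ∧ AlternatesFrom (fun a b => b < a) L} =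
        {[]} := by
      ext L
      simp only [Set.mem_ofPred_eq, Set.mem_singleton_iff]
      constructor
      · rintro ⟨h, -⟩
        exact (List.toFinset_eq_empty_iff _).1 h.2
      · rintro rfl
        simp [BS.IsPermOf, AlternatesFrom]
    rw [this, Set.ncard_singleton, entringer]
  | succ m =>
    have : IsStrictTotalOrder ℕ (fun a b => b < a) :=
      inferInstanceAs (IsStrictTotalOrder ℕ (Function.swap (· < ·)))
    set S := Finset.Icc 1 (m + 1)
    have hS : S.card = m + 1 := by simp [S]
    choose! F hF hFc using fun y hy => exists_card_eq_entringer m (fun a b => b < a) S hS y hy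
    have : {L : List ℕ | BS.IsPermOf S L ∧ AlternatesFrom (fun a b => b < a) L} =
        (S.biUnion F : Finset (List ℕ)) := by
      ext L
      simp only [Set.mem_ofPred_eq, Finset.mem_coe, Finset.mem_biUnion]
      constructor
      · rintro ⟨h1, h2⟩
        cases L with
        | nil =>
          have : S.card = 0 := by rw [← h1.2]; rfl
          omega
        | cons y l =>
          have hy : y ∈ S := by rw [← h1.2]; simp
          exact ⟨y, hy, (hF y hy _).2 ⟨rfl, h1, h2⟩⟩
      · rintro ⟨y, hy, h⟩
        exact ((hF y hy L).1 h).2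
    rw [this, Set.ncard_coe_finset, Finset.card_biUnion]
    · rw [Finset.sum_congr rfl hFc,
        sum_rank_eq_sum_range (fun a b => b < a) S (entringer m), hS, entringer,
        ← Finset.sum_range_reflect]
      rfl
    · intro y hy z hz hyz
      refine Finset.disjoint_left.2 fun L h1 h2 => hyz ?_
      have e1 := ((hF y hy L).1 h1).1
      have e2 := ((hF z hz L).1 h2).1
      exact Option.some_injective _ (e1.symm.trans e2)

theorem entringer_succ_succ (m k : ℕ) :
    entringer (m + 1) (k + 1) = entringer (m + 1) k + entringer m (m - k) := by
  rw [entringer, Finset.sum_range_succ, entringer]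

theorem entringer_second_difference {m k : ℕ} (hk : k ≤ m) :
    entringer (m + 2) (k + 2) + entringer (m + 2) k + entringer m k =
      2 * entringer (m + 2) (k + 1) := by
  have h1 := entringer_succ_succ (m + 1) (k + 1)
  have h2 := entringer_succ_succ (m + 1) k
  have h3 := entringer_succ_succ m (m - k)
  rw [show m + 1 - (k + 1) = m - k by omega] at h1
  rw [show m + 1 - k = m - k + 1 by omega] at h2
  rw [Nat.sub_sub_self hk] at h3
  simp only [add_assoc, one_add_one_eq_two] at h1 h2 h3 ⊢
  omega

theorem entringer_even_eq_sum (n k : ℕ) (hk : k ≤ 2 * n) :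
    (entringer (2 * n) (2 * n - k) : ℚ) = ∑ j ∈ Finset.range (n + 1),
      (-1) ^ j * (k.choose (2 * j) : ℚ) * entringer (2 * (n - j)) (2 * (n - j)) := by
  induction n generalizing k with
  | zero =>
    obtain rfl : k = 0 := by omega
    simp
  | succ n ih =>
    induction k using Nat.twoStepInduction with
    | zero =>
      rw [Finset.sum_range_succ', Finset.sum_eq_zero]
      · simp
      · intro j _
        rw [Nat.choose_eq_zero_of_lt (by omega)]
        simp
    | one =>
      rw [Finset.sum_range_succ', Finset.sum_eq_zero]
      · have := entringer_succ_succ (2 * n + 1) (2 * n + 1)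
        simp only [tsub_self] at this
        rw [show entringer (2 * n + 1) 0 = 0 by simp [entringer]] at this
        simp [mul_add, this]
      · intro j _
        rw [Nat.choose_eq_zero_of_lt (by omega)]
        simp
    | more k h0 h1 =>
      have h0 := h0 (by omega)
      have h1 := h1 (by omega)
      have hn := ih k (by omega)
      have hd := entringer_second_difference (m := 2 * n) (k := 2 * n - k) (by omega)
      rw [show 2 * (n + 1) - k = 2 * n - k + 2 by omega] at h0
      rw [show 2 * (n + 1) - (k + 1) = 2 * n - k + 1 by omega] at h1
      rw [show 2 * (n + 1) - (k + 2) = 2 * n - k by omega]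
      rw [mul_add, mul_one] at *
      have hd' : (entringer (2 * n + 2) (2 * n - k) : ℚ) = 2 * entringer (2 * n + 2) (2 * n - k + 1)
          - entringer (2 * n + 2) (2 * n - k + 2) - entringer (2 * n) (2 * n - k) := by
        rw [eq_sub_iff_add_eq, eq_sub_iff_add_eq]
        exact_mod_cast (by omega)
      rw [hd', h0, h1, hn, Finset.sum_range_succ' _ (n + 1), Finset.sum_range_succ' _ (n + 1),
        Finset.sum_range_succ' _ (n + 1)]
      simp only [mul_zero, Nat.choose_zero_right]
      have key : ∀ j ∈ Finset.range (n + 1),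
          (-1 : ℚ) ^ (j + 1) * ((k + 2).choose (2 * (j + 1)) : ℚ) *
            entringer (2 * (n + 1 - (j + 1))) (2 * (n + 1 - (j + 1))) =
          2 * ((-1 : ℚ) ^ (j + 1) * ((k + 1).choose (2 * (j + 1)) : ℚ) *
            entringer (2 * (n + 1 - (j + 1))) (2 * (n + 1 - (j + 1)))) -
          (-1 : ℚ) ^ (j + 1) * (k.choose (2 * (j + 1)) : ℚ) *
            entringer (2 * (n + 1 - (j + 1))) (2 * (n + 1 - (j + 1))) -
          (-1 : ℚ) ^ j * (k.choose (2 * j) : ℚ) *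
            entringer (2 * (n - j)) (2 * (n - j)) := by
        intro j _
        rw [show 2 * (j + 1) = 2 * j + 1 + 1 by ring, Nat.choose_succ_succ (k + 1),
          Nat.choose_succ_succ k (2 * j), Nat.choose_succ_succ k (2 * j + 1),
          Nat.add_sub_add_right]
        push_cast
        ring
      rw [Finset.sum_congr rfl key]
      simp only [Finset.sum_sub_distrib, ← Finset.mul_sum]
      ring

open Finset in
theorem sum_range_two_mul {M : Type*} [AddCommMonoid M] (f : ℕ → M) (n : ℕ) :
    ∑ i ∈ range (2 * n), f i = ∑ i ∈ range n, (f (2 * i) + f (2 * i + 1)) := by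
  induction n with
  | zero => simp
  | succ n ih =>
    rw [mul_add, mul_one, Finset.sum_range_succ, Finset.sum_range_succ, ih, Finset.sum_range_succ,
      add_assoc]

open PowerSeries in
/-- The generating function of `B_n(1/4) - B_n(3/4)` is `-t / (e^(t/4) + e^(-t/4))`. -/
theorem bernoulli_quarter_generating_function :
    (mk fun n => (Polynomial.bernoulli n).eval (1 / 4 : ℚ) / n.factorial -
        (Polynomial.bernoulli n).eval (3 / 4 : ℚ) / n.factorial) *
      (rescale (1 / 4) (exp ℚ) + rescale (-1 / 4) (exp ℚ)) = -X := by
  have h1 := Polynomial.bernoulli_generating_function (1 / 4 : ℚ)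
  have h3 := Polynomial.bernoulli_generating_function (3 / 4 : ℚ)
  have hadd (a b : ℚ) : rescale (a + b) (exp ℚ) = rescale a (exp ℚ) * rescale b (exp ℚ) :=
    (exp_mul_exp_eq_exp_add a b).symm
  have hD : (mk fun n => (Polynomial.bernoulli n).eval (1 / 4 : ℚ) / n.factorial -
        (Polynomial.bernoulli n).eval (3 / 4 : ℚ) / n.factorial) =
      (mk fun n => Polynomial.aeval (1 / 4 : ℚ) ((1 / n.factorial : ℚ) • Polynomial.bernoulli n)) -
      (mk fun n => Polynomial.aeval (3 / 4 : ℚ) ((1 / n.factorial : ℚ) • Polynomial.bernoulli n)) := by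
    ext n
    simp [Polynomial.coe_aeval_eq_eval]
    ring
  rw [hD]
  set P := mk fun n => Polynomial.aeval (1 / 4 : ℚ) ((1 / n.factorial : ℚ) • Polynomial.bernoulli n)
  set Q := mk fun n => Polynomial.aeval (3 / 4 : ℚ) ((1 / n.factorial : ℚ) • Polynomial.bernoulli n)
  set e := rescale (1 / 4) (exp ℚ) with he
  set e' := rescale (-1 / 4) (exp ℚ) with he'
  have h0 : e * e' = 1 := by
    rw [he, he', ← hadd]
    norm_num
  have e2 : rescale (1 / 2) (exp ℚ) = e ^ 2 := by
    rw [he, pow_two, ← hadd]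
    norm_num
  have e3 : rescale (3 / 4) (exp ℚ) = e ^ 3 := by
    rw [pow_succ, ← e2, he, ← hadd]
    norm_num
  have e4 : exp ℚ = e ^ 4 := by
    rw [show e ^ 4 = e ^ 2 * e ^ 2 by ring, ← e2, ← hadd]
    norm_num
  have hne : e * (e ^ 2 - 1) ≠ 0 := by
    refine mul_ne_zero (left_ne_zero_of_mul_eq_one h0) fun h => ?_
    have := congrArg (coeff 1) h
    rw [← e2] at this
    simp [coeff_rescale, coeff_exp, coeff_one] at this
  rw [e3, e4] at h3
  rw [e4] at h1
  refine mul_right_cancel₀ hne ?_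
  linear_combination h1 - h3 + (P - Q) * (e ^ 2 - 1) * h0

/-- The convolution recurrence for the values of the odd Bernoulli polynomials at `1/4`. -/
theorem sum_bernoulli_quarter (n : ℕ) :
    ∑ j ∈ Finset.range (n + 1), (-1) ^ j / ((2 * j).factorial : ℚ) *
      ((-1) ^ (n - j + 1) * 4 * 16 ^ (n - j) *
        ((Polynomial.bernoulli (2 * (n - j) + 1)).eval (1 / 4 : ℚ) /
          (2 * (n - j) + 1).factorial)) = if n = 0 then 1 else 0 := by
  have h := congrArg (PowerSeries.coeff (2 * n + 1)) bernoulli_quarter_generating_function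
  rw [mul_comm (PowerSeries.mk _), PowerSeries.coeff_mul,
    Finset.Nat.sum_antidiagonal_eq_sum_range_succ_mk,
    show (2 * n + 1).succ = 2 * (n + 1) by rw [Nat.succ_eq_add_one]; ring, sum_range_two_mul] at h
  have hr : PowerSeries.coeff (2 * n + 1) (-PowerSeries.X : PowerSeries ℚ) =
      - if n = 0 then 1 else 0 := by
    rw [map_neg, PowerSeries.coeff_X]
    simp
  have hn : (if n = 0 then 1 else 0 : ℚ) = -(-16) ^ n * (- if n = 0 then 1 else 0) := by
    split_ifs with hn <;> simp [hn]
  rw [hn, ← hr, ← h, Finset.mul_sum]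
  refine Finset.sum_congr rfl fun j hj => ?_
  obtain ⟨m, rfl⟩ : ∃ m, n = j + m :=
    ⟨n - j, by have := Finset.mem_range.1 hj; omega⟩
  have hB : (Polynomial.bernoulli (2 * m + 1)).eval (3 / 4 : ℚ) =
      -(Polynomial.bernoulli (2 * m + 1)).eval (1 / 4 : ℚ) := by
    have := Polynomial.bernoulli_eval_one_sub (2 * m + 1) (1 / 4)
    rw [show (1 - 1 / 4 : ℚ) = 3 / 4 by norm_num, Odd.neg_one_pow ⟨m, rfl⟩] at this
    linarith
  have h4 : (-1 / 4 : ℚ) ^ (2 * j + 1) = -(1 / 4) ^ (2 * j + 1) := by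
    rw [neg_div, Odd.neg_pow ⟨j, rfl⟩]
  have h4' : (-1 / 4 : ℚ) ^ (2 * j) = (1 / 4) ^ (2 * j) := by
    rw [neg_div, Even.neg_pow ⟨j, two_mul j⟩]
  have h16 : (1 / 4 : ℚ) ^ (2 * j) = (16 ^ j)⁻¹ := by
    rw [pow_mul, ← inv_pow]
    norm_num
  simp only [map_add, PowerSeries.coeff_rescale, PowerSeries.coeff_exp, PowerSeries.coeff_mk, h4,
    h4', h16, show j + m - j = m by omega, show 2 * (j + m) + 1 - 2 * j = 2 * m + 1 by omega, hB]
  rw [neg_pow (16 : ℚ)]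
  simp only [pow_add, pow_one, eq_ratCast, Rat.cast_eq_id, id]
  have : ((-1 : ℚ) ^ j) ^ 2 = 1 := by rw [← pow_mul, mul_comm, pow_mul]; simp
  field_simp
  ring

/-- A sequence is determined by its convolution with the Taylor coefficients of the cosine. -/
theorem eq_of_sum_cos_coeff_eq {x y : ℕ → ℚ}
    (h : ∀ n, ∑ j ∈ Finset.range (n + 1), (-1) ^ j / ((2 * j).factorial : ℚ) * x (n - j) =
      ∑ j ∈ Finset.range (n + 1), (-1) ^ j / ((2 * j).factorial : ℚ) * y (n - j)) (n : ℕ) :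
    x n = y n := by
  induction n using Nat.strong_induction_on with
  | _ n ih =>
    have hn := h n
    rw [Finset.sum_range_succ', Finset.sum_range_succ', Finset.sum_congr rfl fun j hj => by
      rw [ih (n - (j + 1)) (by have := Finset.mem_range.1 hj; omega)]] at hn
    simpa using hn

open Filter Topology in
theorem tendsto_alternating_odd_pow {n : ℕ} (hn : n ≠ 0) :
    Tendsto (fun N => ∑ i ∈ Finset.range N, (-1 : ℝ) ^ i * (1 / (2 * i + 1 : ℝ) ^ (2 * n + 1)))
      atTop (𝓝 (Real.pi / 4 * (Real.pi ^ 2 / 4) ^ n *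
        (((-1) ^ (n + 1) * 4 * 16 ^ n * ((Polynomial.bernoulli (2 * n + 1)).eval (1 / 4 : ℚ) /
          (2 * n + 1).factorial) : ℚ) : ℝ))) := by
  have h := (hasSum_one_div_nat_pow_mul_sin hn (x := ((1 / 4 : ℚ) : ℝ))
    (by norm_num)).tendsto_sum_nat.comp (tendsto_id.const_mul_atTop' (show 0 < 2 by norm_num))
  have hB : ((Polynomial.bernoulli (2 * n + 1)).map (algebraMap ℚ ℝ)).eval ((1 / 4 : ℚ) : ℝ) =
      (((Polynomial.bernoulli (2 * n + 1)).eval (1 / 4 : ℚ) : ℚ) : ℝ) :=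
    Polynomial.eval_map_apply (algebraMap ℚ ℝ) (1 / 4 : ℚ)
  rw [hB] at h
  convert h using 1
  · ext N
    simp only [Function.comp, id]
    rw [sum_range_two_mul]
    refine Finset.sum_congr rfl fun i _ => ?_
    have h1 : Real.sin (2 * Real.pi * ((2 * i : ℕ) : ℝ) * ((1 / 4 : ℚ) : ℝ)) = 0 := by
      rw [← Real.sin_nat_mul_pi i]
      congr 1
      push_cast
      ring
    have h2 : Real.sin (2 * Real.pi * ((2 * i + 1 : ℕ) : ℝ) * ((1 / 4 : ℚ) : ℝ)) = (-1) ^ i := by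
      rw [← Real.cos_nat_mul_pi i, ← Real.sin_add_pi_div_two]
      congr 1
      push_cast
      ring
    rw [h1, h2]
    push_cast
    ring
  · congr 1
    push_cast
    rw [div_pow, ← pow_mul, mul_pow, pow_succ (2 : ℝ), pow_succ Real.pi, pow_mul (2 : ℝ),
      show (16 : ℝ) ^ n = 4 ^ n * 4 ^ n by rw [← mul_pow]; norm_num]
    norm_num
    field_simp

theorem antitone_one_div_odd_pow (s : ℕ) : Antitone fun i : ℕ => 1 / (2 * i + 1 : ℝ) ^ s := by
  intro i j hij
  have : (i : ℝ) ≤ j := by exact_mod_cast hij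
  dsimp only
  gcongr

open Filter Topology in
/-- If `α * β ^ n * c n` is the value of the Dirichlet beta function at `2 * n + 1` for all `n ≠ 0`,
then `c` is strictly log-concave from index `1` on. -/
theorem mul_lt_sq_of_tendsto_alternating {c : ℕ → ℝ} {α β : ℝ} (hα : 0 < α) (hβ : 0 < β)
    (h : ∀ n, n ≠ 0 → Tendsto (fun N => ∑ i ∈ Finset.range N,
      (-1 : ℝ) ^ i * (1 / (2 * i + 1 : ℝ) ^ (2 * n + 1))) atTop (𝓝 (α * β ^ n * c n)))
    {n : ℕ} (hn : n ≠ 0) : c n * c (n + 2) < c (n + 1) ^ 2 := by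
  have hu := (antitone_one_div_odd_pow _).tendsto_le_alternating_series (h n hn) 1
  have hl := (antitone_one_div_odd_pow _).alternating_series_le_tendsto (h n hn) 1
  have hl' := (antitone_one_div_odd_pow _).alternating_series_le_tendsto (h (n + 1) (by omega)) 1
  have hu' := (antitone_one_div_odd_pow _).tendsto_le_alternating_series (h (n + 2) (by omega)) 0
  norm_num [Finset.sum_range_succ] at hu hl hl' hu'
  set a := α * β ^ n * c n
  set d := α * β ^ (n + 1) * c (n + 1)
  set e := α * β ^ (n + 2) * c (n + 2)
  have h35 : ((5 : ℝ) ^ (2 * n + 1))⁻¹ < 7 / 9 * (3 ^ (2 * n + 1))⁻¹ := by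
    have : (9 : ℝ) * 3 ^ (2 * n + 1) < 7 * 5 ^ (2 * n + 1) := by
      clear * -
      induction n with
      | zero => norm_num
      | succ n ih =>
        rw [show 2 * (n + 1) + 1 = 2 * n + 1 + 2 by ring, pow_add (3 : ℝ) (2 * n + 1) 2,
          pow_add (5 : ℝ) (2 * n + 1) 2]
        nlinarith [pow_pos (show (0 : ℝ) < 5 by norm_num) (2 * n + 1)]
    rw [← div_eq_mul_inv, div_div, inv_eq_one_div, div_lt_div_iff₀ (by positivity) (by positivity)]
    linarith
  have h3 : ((3 : ℝ) ^ (2 * (n + 1) + 1))⁻¹ = (3 ^ (2 * n + 1))⁻¹ / 9 := by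
    rw [show 2 * (n + 1) + 1 = 2 * n + 1 + 2 by ring, pow_add _ _ 2, mul_inv]
    norm_num [div_eq_mul_inv]
  have ht : ((3 : ℝ) ^ (2 * n + 1))⁻¹ ≤ 1 := inv_le_one_of_one_le₀ (one_le_pow₀ (by norm_num))
  have ht0 : 0 < ((3 : ℝ) ^ (2 * n + 1))⁻¹ := by positivity
  rw [h3] at hl'
  set t := ((3 : ℝ) ^ (2 * n + 1))⁻¹
  have key : a * e < d ^ 2 := by
    have h1 : a * e ≤ a := mul_le_of_le_one_right (by linarith) (by linarith)
    have h2 : (1 - t / 9) ^ 2 ≤ d ^ 2 := pow_le_pow_left₀ (by linarith) (by linarith) 2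
    nlinarith
  have hab : a * e = (α * β ^ (n + 1)) ^ 2 * (c n * c (n + 2)) := by ring
  have hd : d ^ 2 = (α * β ^ (n + 1)) ^ 2 * c (n + 1) ^ 2 := by ring
  rw [hab, hd] at key
  exact lt_of_mul_lt_mul_left key (by positivity)

/-- The secant numbers satisfy the recurrence expressing `sec x * cos x = 1`. -/
theorem sum_zigzag_even (n : ℕ) :
    ∑ j ∈ Finset.range (n + 1), (-1) ^ j / ((2 * j).factorial : ℚ) *
      ((zigzag (2 * (n - j)) : ℚ) / (2 * (n - j)).factorial) = if n = 0 then 1 else 0 := by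
  have h := entringer_even_eq_sum n (2 * n) le_rfl
  have h0 : (entringer (2 * n) (2 * n - 2 * n) : ℚ) = (2 * n).factorial * if n = 0 then 1 else 0 := by
    cases n with
    | zero => simp [entringer]
    | succ n => simp [mul_add, entringer]
  have hne : ((2 * n).factorial : ℚ) ≠ 0 := by exact_mod_cast (2 * n).factorial_ne_zero
  rw [← mul_right_inj' hne, ← h0, h, Finset.mul_sum]
  refine Finset.sum_congr rfl fun j hj => ?_
  have hj : j ≤ n := by have := Finset.mem_range.1 hj; omega
  rw [Nat.cast_choose ℚ (by omega : 2 * j ≤ 2 * n), zigzag_eq_entringer, Nat.mul_sub]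
  field_simp

/-- The secant numbers in terms of values of Bernoulli polynomials. -/
theorem zigzag_even_div_factorial (n : ℕ) :
    (zigzag (2 * n) : ℚ) / (2 * n).factorial = (-1) ^ (n + 1) * 4 * 16 ^ n *
      ((Polynomial.bernoulli (2 * n + 1)).eval (1 / 4 : ℚ) / (2 * n + 1).factorial) :=
  eq_of_sum_cos_coeff_eq (x := fun n => (zigzag (2 * n) : ℚ) / (2 * n).factorial)
    (y := fun n => (-1) ^ (n + 1) * 4 * 16 ^ n *
      ((Polynomial.bernoulli (2 * n + 1)).eval (1 / 4 : ℚ) / (2 * n + 1).factorial))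
    (fun n => (sum_zigzag_even n).trans (sum_bernoulli_quarter n).symm) n

/-- The sequence `a_{2k}/(2k)!` of normalized Euler zigzag numbers is strictly
log-concave: `(a_{2k}/(2k)!)² > (a_{2k-2}/(2k-2)!)·(a_{2k+2}/(2k+2)!)` for `k ≥ 1`. -/
theorem zigzag_div_factorial_strict_log_concave (k : ℕ) (hk : 1 ≤ k) :
    ((zigzag (2 * k) : ℚ) / (Nat.factorial (2 * k) : ℚ)) ^ 2 >
      ((zigzag (2 * k - 2) : ℚ) / (Nat.factorial (2 * k - 2) : ℚ)) *
        ((zigzag (2 * k + 2) : ℚ) / (Nat.factorial (2 * k + 2) : ℚ)) := by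
  obtain ⟨n, rfl⟩ := Nat.exists_eq_add_of_le' hk
  rw [show 2 * (n + 1) - 2 = 2 * n by omega, show 2 * (n + 1) + 2 = 2 * (n + 2) by ring]
  rcases eq_or_ne n 0 with rfl | hn
  · simp [zigzag_eq_entringer, entringer, Finset.sum_range_succ, Nat.factorial]
    norm_num
  · have h := mul_lt_sq_of_tendsto_alternating
      (c := fun n => (((zigzag (2 * n) : ℚ) / (2 * n).factorial : ℚ) : ℝ))
      (α := Real.pi / 4) (β := Real.pi ^ 2 / 4) (by positivity) (by positivity)
      (fun n hn => by
        rw [zigzag_even_div_factorial]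
        exact tendsto_alternating_odd_pow hn) hn
    exact_mod_cast h
end

section
/- For fixed positive integer n, the sequence β_k = C(n+1, 2k)·a_{2k} (for k ≥ 0 with 2k ≤ n+1) is log-concave: β_k² ≥ β_{k-1}·β_{k+1}. In fact, β_k²/(β_{k-1}β_{k+1}) = [(n+3-2k)(n+2-2k)/((n+1-2k)(n-2k))] · (α_k²/(α_{k-1}α_{k+1})) > 1, where α_k = a_{2k}/(2k)!. -/
open Finset

namespace BS

/-! ### Alternating arrangements of a finite set -/

theorem IsPermOf.length_eq {S : Finset ℕ} {L : List ℕ} (h : IsPermOf S L) :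
    L.length = S.card := by
  rw [← h.2, List.toFinset_card_of_nodup h.1]

theorem IsAlternating.map {S : Finset ℕ} {L : List ℕ} {f : ℕ → ℕ} (hf : StrictMonoOn f S)
    (hL : ∀ a ∈ L, a ∈ S) (h : IsAlternating L) : IsAlternating (L.map f) := by
  intro i hi
  rw [List.length_map] at hi
  have h' := h i hi
  have hi' : i < L.length := by omega
  rw [List.getD_eq_getElem _ _ hi, List.getD_eq_getElem _ _ hi'] at h'
  rw [List.getD_eq_getElem _ _ (by simpa using hi), List.getD_eq_getElem _ _ (by simpa using hi'),
    List.getElem_map, List.getElem_map]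
  have m₁ : L[i] ∈ S := hL _ (List.getElem_mem _)
  have m₂ : L[i + 1] ∈ S := hL _ (List.getElem_mem _)
  exact ⟨fun h0 => hf m₂ m₁ (h'.1 h0), fun h1 => hf m₁ m₂ (h'.2 h1)⟩

theorem finite_setOf_isPermOf (S : Finset ℕ) : {L : List ℕ | IsPermOf S L}.Finite := by
  refine (List.finite_toSet S.toList.permutations).subset fun L hL => ?_
  rw [Set.mem_ofPred_eq, List.mem_permutations]
  refine (List.perm_ext_iff_of_nodup hL.1 S.nodup_toList).2 fun a => ?_
  rw [Finset.mem_toList, ← hL.2, List.mem_toFinset]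

/-- The alternating arrangements of the finite set `S`. -/
noncomputable def alternatingLists (S : Finset ℕ) : Finset (List ℕ) :=
  ((finite_setOf_isPermOf S).subset fun _ h => h.1 :
    {L : List ℕ | IsPermOf S L ∧ IsAlternating L}.Finite).toFinset

theorem mem_alternatingLists {S : Finset ℕ} {L : List ℕ} :
    L ∈ alternatingLists S ↔ IsPermOf S L ∧ IsAlternating L := by
  simp [alternatingLists]

theorem zigzag_eq_card (m : ℕ) : zigzag m = (alternatingLists (Icc 1 m)).card :=
  Set.ncard_eq_toFinset_card _ _

theorem exists_strictMonoOn_image_eq {S T : Finset ℕ} (h : S.card = T.card) :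
    ∃ f : ℕ → ℕ, StrictMonoOn f S ∧ S.image f = T := by
  let e : S ≃o T := (S.orderIsoOfFin h).symm.trans (T.orderIsoOfFin rfl)
  let f : ℕ → ℕ := fun x => if hx : x ∈ S then e ⟨x, hx⟩ else 0
  have hf : ∀ x (hx : x ∈ S), f x = e ⟨x, hx⟩ := fun x hx => dif_pos hx
  refine ⟨f, fun x hx y hy hxy => ?_, ?_⟩
  · rw [hf x hx, hf y hy]
    exact e.strictMono (show (⟨x, hx⟩ : S) < ⟨y, hy⟩ from hxy)
  · ext y
    rw [mem_image]
    constructor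
    · rintro ⟨x, hx, rfl⟩
      rw [hf x hx]
      exact (e ⟨x, hx⟩).2
    · intro hy
      refine ⟨e.symm ⟨y, hy⟩, (e.symm ⟨y, hy⟩).2, ?_⟩
      rw [hf _ (e.symm ⟨y, hy⟩).2]
      simp

theorem card_alternatingLists_le {S T : Finset ℕ} (h : S.card = T.card) :
    (alternatingLists S).card ≤ (alternatingLists T).card := by
  obtain ⟨f, hf, rfl⟩ := exists_strictMonoOn_image_eq h
  refine card_le_card_of_injOn (List.map f) (fun L hL => ?_) fun L hL L' hL' e => ?_
  · rw [mem_coe, mem_alternatingLists] at hL ⊢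
    obtain ⟨⟨hn, rfl⟩, ha⟩ := hL
    refine ⟨⟨hn.map_on fun a ha b hb hab => hf.injOn (by simpa using ha) (by simpa using hb) hab,
      ?_⟩, ha.map hf (by simp)⟩
    ext; simp
  · rw [mem_coe, mem_alternatingLists] at hL hL'
    have mem : ∀ {M : List ℕ}, IsPermOf S M → ∀ a ∈ M, a ∈ S := fun hM a ha => by
      rw [← hM.2]; simpa using ha
    have hlen : L.length = L'.length := by rw [hL.1.length_eq, hL'.1.length_eq]
    refine List.ext_getElem hlen fun i hi hi' => ?_
    refine hf.injOn (mem hL.1 _ (List.getElem_mem _)) (mem hL'.1 _ (List.getElem_mem _)) ?_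
    have := congrArg (fun M : List ℕ => M[i]?) e
    simpa [hi, hi'] using this

theorem card_alternatingLists (S : Finset ℕ) : (alternatingLists S).card = zigzag S.card := by
  rw [zigzag_eq_card]
  have h : S.card = (Icc 1 S.card).card := by simp
  exact (card_alternatingLists_le h).antisymm (card_alternatingLists_le h.symm)

theorem zigzag_two_mul_pos (k : ℕ) : 0 < zigzag (2 * k) := by
  rw [zigzag_eq_card, card_pos]
  let f : ℕ → ℕ := fun i => if i % 2 = 0 then i + 2 else i
  refine ⟨(List.range (2 * k)).map f, mem_alternatingLists.2 ⟨⟨?_, ?_⟩, ?_⟩⟩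
  · refine List.nodup_range.map fun a b hab => ?_
    simp only [f] at hab
    split_ifs at hab <;> omega
  · ext a
    simp only [List.mem_toFinset, List.mem_map, List.mem_range, mem_Icc, f]
    constructor
    · rintro ⟨b, hb, rfl⟩
      split_ifs <;> omega
    · intro ha
      refine ⟨if a % 2 = 0 then a - 2 else a, ?_, ?_⟩ <;> split_ifs <;> omega
  · intro i hi
    rw [List.length_map, List.length_range] at hi
    rw [List.getD_eq_getElem _ _ (by simpa using hi),
      List.getD_eq_getElem _ _ (by simp; omega)]
    simp only [List.getElem_map, List.getElem_range, f]
    constructor <;> intro h <;> split_ifs <;> omega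

/-! ### Pairs of alternating lists sharing the letters `1, …, p + q` -/

/-- Pairs of alternating lists of lengths `p` and `q` which together use each of
`1, …, p + q` exactly once. -/
def alternatingPairs (p q : ℕ) : Set (List ℕ × List ℕ) :=
  {w | w.1.length = p ∧ w.2.length = q ∧ IsPermOf (Icc 1 (p + q)) (w.1 ++ w.2) ∧
    IsAlternating w.1 ∧ IsAlternating w.2}

theorem alternatingPairs_eq (p q : ℕ) :
    alternatingPairs p q = ((powersetCard p (Icc 1 (p + q))).biUnion fun S =>
      alternatingLists S ×ˢ alternatingLists (Icc 1 (p + q) \ S) : Finset (List ℕ × List ℕ)) := by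
  ext ⟨x, y⟩
  simp only [alternatingPairs, Set.mem_ofPred_eq, coe_biUnion, Set.mem_iUnion, mem_coe,
    mem_product, mem_alternatingLists, mem_powersetCard]
  constructor
  · rintro ⟨hx, hy, ⟨hn, hU⟩, ax, ay⟩
    rw [List.nodup_append'] at hn
    rw [List.toFinset_append] at hU
    refine ⟨x.toFinset, ⟨hU ▸ subset_union_left, ?_⟩, ⟨⟨hn.1, rfl⟩, ax⟩, ⟨hn.2.1, ?_⟩, ay⟩
    · rw [List.toFinset_card_of_nodup hn.1, hx]
    · rw [← hU, union_sdiff_cancel_left]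
      exact List.disjoint_toFinset_iff_disjoint.2 hn.2.2
  · rintro ⟨S, ⟨hS, hc⟩, ⟨hx, ax⟩, hy, ay⟩
    have hx' := hx.length_eq
    have hy' := hy.length_eq
    rw [card_sdiff_of_subset hS, Nat.card_Icc] at hy'
    refine ⟨by omega, by omega, ⟨?_, ?_⟩, ax, ay⟩
    · refine List.nodup_append'.2 ⟨hx.1, hy.1, ?_⟩
      rw [← List.disjoint_toFinset_iff_disjoint, hx.2, hy.2]
      exact disjoint_sdiff
    · rw [List.toFinset_append, hx.2, hy.2, union_sdiff_of_subset hS]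

theorem finite_alternatingPairs (p q : ℕ) : (alternatingPairs p q).Finite := by
  rw [alternatingPairs_eq]
  exact finite_toSet _

theorem ncard_alternatingPairs (p q : ℕ) :
    (alternatingPairs p q).ncard = (p + q).choose p * (zigzag p * zigzag q) := by
  rw [alternatingPairs_eq, Set.ncard_coe_finset, card_biUnion]
  · rw [sum_congr rfl (g := fun _ => zigzag p * zigzag q), sum_const, card_powersetCard,
      Nat.card_Icc, smul_eq_mul, Nat.add_sub_cancel]
    intro S hS
    rw [mem_powersetCard] at hS
    rw [card_product, card_alternatingLists, card_alternatingLists, card_sdiff_of_subset hS.1,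
      hS.2, Nat.card_Icc, Nat.add_sub_cancel, Nat.add_sub_cancel_left]
  · intro S _ T _ hST
    rw [Function.onFun, disjoint_left]
    rintro ⟨x, y⟩ h h'
    rw [mem_product, mem_alternatingLists] at h h'
    exact hST (h.1.1.2.symm.trans h'.1.1.2)

/-! ### Exchanging tails -/

/-- Exchange the tail of `w.1` from position `d + 2` on with the tail of `w.2` from
position `d` on. -/
def swapTails (d : ℕ) (w : List ℕ × List ℕ) : List ℕ × List ℕ :=
  (w.1.take (d + 2) ++ w.2.drop d, w.2.take d ++ w.1.drop (d + 2))

theorem swapTails_swapTails {d : ℕ} {w : List ℕ × List ℕ} (h₁ : d + 2 ≤ w.1.length)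
    (h₂ : d ≤ w.2.length) : swapTails d (swapTails d w) = w := by
  have e₁ : (w.1.take (d + 2)).length = d + 2 := by simpa using h₁
  have e₂ : (w.2.take d).length = d := by simpa using h₂
  ext1 <;> simp only [swapTails]
  · rw [List.take_left' e₁, List.drop_left' e₂, List.take_append_drop]
  · rw [List.take_left' e₂, List.drop_left' e₁, List.take_append_drop]

theorem getD_swapTails_fst {d : ℕ} {w : List ℕ × List ℕ} (h₁ : d + 2 ≤ w.1.length) (i : ℕ) :
    (swapTails d w).1.getD i 0 = if i < d + 2 then w.1.getD i 0 else w.2.getD (i - 2) 0 := by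
  simp only [swapTails, List.getD_eq_getElem?_getD]
  split_ifs with h
  · rw [List.getElem?_append_left (by simp; omega), List.getElem?_take_of_lt h]
  · rw [List.getElem?_append_right (by simp; omega), List.getElem?_drop, List.length_take,
      min_eq_left h₁]
    congr 2; omega

theorem getD_swapTails_snd {d : ℕ} {w : List ℕ × List ℕ} (h₂ : d ≤ w.2.length) (i : ℕ) :
    (swapTails d w).2.getD i 0 = if i < d then w.2.getD i 0 else w.1.getD (i + 2) 0 := by
  simp only [swapTails, List.getD_eq_getElem?_getD]
  split_ifs with h
  · rw [List.getElem?_append_left (by simp; omega), List.getElem?_take_of_lt h]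
  · rw [List.getElem?_append_right (by simp; omega), List.getElem?_drop, List.length_take,
      min_eq_left h₂]
    congr 2; omega

theorem swapTails_perm (d : ℕ) (w : List ℕ × List ℕ) :
    ((swapTails d w).1 ++ (swapTails d w).2).Perm (w.1 ++ w.2) := by
  rw [← Multiset.coe_eq_coe]
  conv_rhs => rw [← List.take_append_drop (d + 2) w.1, ← List.take_append_drop d w.2]
  simp only [swapTails, ← Multiset.coe_add]
  abel

/-- The order relation between the entries at positions `i` and `i + 1` of an alternating list. -/
def Step (i a b : ℕ) : Prop :=
  (i % 2 = 0 → b < a) ∧ (i % 2 = 1 → a < b)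

/-- The two junctions created by `swapTails d w` respect the alternation. -/
def Swappable (d : ℕ) (w : List ℕ × List ℕ) : Prop :=
  (d < w.2.length → Step (d + 1) (w.1.getD (d + 1) 0) (w.2.getD d 0)) ∧
  (1 ≤ d → d + 2 < w.1.length → Step (d + 1) (w.2.getD (d - 1) 0) (w.1.getD (d + 2) 0))

theorem isAlternating_swapTails {d : ℕ} {w : List ℕ × List ℕ} (h₁ : d + 2 ≤ w.1.length)
    (h₂ : d ≤ w.2.length) (a₁ : IsAlternating w.1) (a₂ : IsAlternating w.2)
    (h : Swappable d w) :
    IsAlternating (swapTails d w).1 ∧ IsAlternating (swapTails d w).2 := by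
  constructor
  · intro i hi
    rw [getD_swapTails_fst h₁, getD_swapTails_fst h₁]
    simp only [swapTails, List.length_append, List.length_take, List.length_drop] at hi
    rcases lt_trichotomy i (d + 1) with hid | rfl | hid
    · rw [if_pos (by omega), if_pos (by omega)]
      exact a₁ i (by omega)
    · rw [if_neg (by omega), if_pos (by omega)]
      exact h.1 (by omega)
    · rw [if_neg (by omega), if_neg (by omega)]
      obtain ⟨j, rfl⟩ : ∃ j, i = j + 2 := ⟨i - 2, by omega⟩
      have := a₂ j (by omega)
      rwa [show j + 2 + 1 - 2 = j + 1 by omega, Nat.add_sub_cancel, Nat.add_mod_right]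
  · intro i hi
    rw [getD_swapTails_snd h₂, getD_swapTails_snd h₂]
    simp only [swapTails, List.length_append, List.length_take, List.length_drop] at hi
    rcases lt_trichotomy (i + 1) d with hid | rfl | hid
    · rw [if_pos (by omega), if_pos (by omega)]
      exact a₂ i (by omega)
    · rw [if_neg (by omega), if_pos (by omega)]
      have := h.2 (by omega) (by omega)
      rwa [Step, show i + 1 + 1 = i + 2 by omega, Nat.add_mod_right, Nat.add_sub_cancel] at this
    · rw [if_neg (by omega), if_neg (by omega)]
      have := a₁ (i + 2) (by omega)
      rwa [Nat.add_mod_right, show i + 2 + 1 = i + 1 + 2 by omega] at this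

theorem exists_swappable {m : ℕ} (hm : Even m) {w : List ℕ × List ℕ}
    (h₁ : w.1.length = m + 4) (h₂ : w.2.length = m) (a₁ : IsAlternating w.1)
    (a₂ : IsAlternating w.2) : ∃ d, d ≤ m ∧ Swappable d w := by
  by_contra! hno
  have key : ∀ t, 2 * t < m ∧ w.2.getD (2 * t) 0 ≤ w.1.getD (2 * t + 1) 0 := by
    intro t
    induction t with
    | zero =>
      have h := hno 0 (Nat.zero_le _)
      simp only [Swappable, Step, h₂] at h
      grind
    | succ t ih =>
      obtain ⟨ht, hle⟩ := ih
      have ho := hno (2 * t + 1) (by grind)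
      have he := hno (2 * t + 2) (by grind)
      have x₁ := (a₁ (2 * t + 1) (by omega)).2 (by omega)
      have x₂ := (a₁ (2 * t + 3) (by omega)).2 (by omega)
      have y₁ := (a₂ (2 * t) (by grind)).1 (by omega)
      have hle' : w.2.getD (2 * t) 0 ≤ w.1.getD (2 * t + 3) 0 := by
        by_contra hc
        refine ho ⟨fun _ => ⟨fun _ => ?_, fun _ => by omega⟩,
          fun _ _ => ⟨fun _ => ?_, fun _ => by omega⟩⟩
        · show w.2.getD (2 * t + 1) 0 < w.1.getD (2 * t + 2) 0
          have x₁' : w.1.getD (2 * t + 1) 0 < w.1.getD (2 * t + 2) 0 := x₁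
          omega
        · show w.1.getD (2 * t + 3) 0 < w.2.getD (2 * t) 0
          omega
      have x₂' : w.1.getD (2 * t + 3) 0 < w.1.getD (2 * t + 4) 0 := x₂
      by_contra hc
      refine he ⟨fun hlt => ⟨fun _ => by omega, fun _ => ?_⟩,
          fun _ _ => ⟨fun _ => by omega, fun _ => ?_⟩⟩
      · rw [show 2 * (t + 1) = 2 * t + 2 by ring] at hc
        show w.1.getD (2 * t + 3) 0 < w.2.getD (2 * t + 2) 0
        change ¬ (2 * t + 2 < m ∧ w.2.getD (2 * t + 2) 0 ≤ w.1.getD (2 * t + 3) 0) at hc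
        rw [h₂] at hlt
        by_contra hc'
        exact hc ⟨hlt, not_lt.1 hc'⟩
      · show w.2.getD (2 * t + 1) 0 < w.1.getD (2 * t + 4) 0
        omega
  have := (key m).1
  omega

theorem swappable_swapTails_self {d m : ℕ} (hd : d ≤ m) {w : List ℕ × List ℕ}
    (h₁ : w.1.length = m + 4) (h₂ : w.2.length = m) (a₁ : IsAlternating w.1)
    (a₂ : IsAlternating w.2) : Swappable d (swapTails d w) := by
  simp only [Swappable, getD_swapTails_fst (show d + 2 ≤ w.1.length by omega),
    getD_swapTails_snd (show d ≤ w.2.length by omega)]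
  refine ⟨fun _ => ?_, fun h0 hlt => ?_⟩
  · rw [if_pos (by omega), if_neg (by omega)]
    exact a₁ (d + 1) (by omega)
  · rw [if_pos (by omega), if_neg (by omega)]
    simp only [swapTails, List.length_append, List.length_take, List.length_drop] at hlt
    obtain ⟨e, rfl⟩ : ∃ e, d = e + 1 := ⟨d - 1, by omega⟩
    have := a₂ e (by omega)
    rwa [Step, show e + 1 + 1 = e + 2 by omega, Nat.add_mod_right, Nat.add_sub_cancel,
      Nat.add_sub_cancel]

theorem swappable_swapTails_iff_of_lt {d e m : ℕ} (hd : d ≤ m) (he : e < d)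
    {w : List ℕ × List ℕ} (h₁ : w.1.length = m + 4) (h₂ : w.2.length = m) :
    Swappable e (swapTails d w) ↔ Swappable e w := by
  have l₁ : e + 2 < (swapTails d w).1.length := by simp [swapTails]; omega
  have l₂ : e < (swapTails d w).2.length := by simp [swapTails]; omega
  simp only [Swappable, getD_swapTails_fst (show d + 2 ≤ w.1.length by omega),
    getD_swapTails_snd (show d ≤ w.2.length by omega), l₁, l₂,
    show e < w.2.length by omega, show e + 2 < w.1.length by omega,
    if_pos (show e + 1 < d + 2 by omega), if_pos he, if_pos (show e - 1 < d by omega),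
    if_pos (show e + 2 < d + 2 by omega)]

/-- The least position at which tails can be exchanged. -/
noncomputable def firstSwap (w : List ℕ × List ℕ) : ℕ :=
  sInf {d | Swappable d w}

theorem firstSwap_spec {m : ℕ} (hm : Even m) {w : List ℕ × List ℕ}
    (h₁ : w.1.length = m + 4) (h₂ : w.2.length = m) (a₁ : IsAlternating w.1)
    (a₂ : IsAlternating w.2) : firstSwap w ≤ m ∧ Swappable (firstSwap w) w := by
  obtain ⟨d, hd, h⟩ := exists_swappable hm h₁ h₂ a₁ a₂
  have hmem : d ∈ {d | Swappable d w} := h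
  exact ⟨(Nat.sInf_le hmem).trans hd, Nat.sInf_mem ⟨d, hmem⟩⟩

theorem firstSwap_swapTails {m : ℕ} (hm : Even m) {w : List ℕ × List ℕ}
    (h₁ : w.1.length = m + 4) (h₂ : w.2.length = m) (a₁ : IsAlternating w.1)
    (a₂ : IsAlternating w.2) : firstSwap (swapTails (firstSwap w) w) = firstSwap w := by
  have hd := (firstSwap_spec hm h₁ h₂ a₁ a₂).1
  have hmem : firstSwap w ∈ {d | Swappable d (swapTails (firstSwap w) w)} :=
    swappable_swapTails_self hd h₁ h₂ a₁ a₂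
  refine le_antisymm (Nat.sInf_le hmem) (le_csInf ⟨_, hmem⟩ fun e he => ?_)
  by_contra! hlt
  exact absurd (Nat.sInf_le ((swappable_swapTails_iff_of_lt hd hlt h₁ h₂).1 he)) (not_le.2 hlt)

theorem ncard_alternatingPairs_le {m : ℕ} (hm : Even m) :
    (alternatingPairs (m + 4) m).ncard ≤ (alternatingPairs (m + 2) (m + 2)).ncard := by
  refine Set.ncard_le_ncard_of_injOn (fun w => swapTails (firstSwap w) w) ?_ ?_
    (finite_alternatingPairs _ _)
  · rintro w ⟨h₁, h₂, hp, a₁, a₂⟩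
    obtain ⟨hd, hs⟩ := firstSwap_spec hm h₁ h₂ a₁ a₂
    have hperm := swapTails_perm (firstSwap w) w
    refine ⟨?_, ?_, ⟨hperm.nodup_iff.2 hp.1, ?_⟩,
      isAlternating_swapTails (by omega) (by omega) a₁ a₂ hs⟩
    · simp [swapTails]; omega
    · simp [swapTails]; omega
    · rw [List.toFinset_eq_of_perm _ _ hperm, hp.2]
      congr 1; omega
  · rintro w ⟨h₁, h₂, -, a₁, a₂⟩ w' ⟨h₁', h₂', -, a₁', a₂'⟩ (e : swapTails _ _ = swapTails _ _)
    have hd := (firstSwap_spec hm h₁ h₂ a₁ a₂).1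
    have hd' := (firstSwap_spec hm h₁' h₂' a₁' a₂').1
    have hdd : firstSwap w = firstSwap w' := by
      rw [← firstSwap_swapTails hm h₁ h₂ a₁ a₂, e, firstSwap_swapTails hm h₁' h₂' a₁' a₂']
    rw [← swapTails_swapTails (d := firstSwap w) (w := w) (by omega) (by omega), e, hdd,
      swapTails_swapTails (by omega) (by omega)]

/-! ### Log-concavity -/

theorem choose_add_two_mul (N j : ℕ) :
    N.choose (j + 2) * ((j + 1) * (j + 2)) = N.choose j * ((N - j) * (N - (j + 1))) := by
  have e₁ := Nat.choose_succ_right_eq N j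
  have e₂ := Nat.choose_succ_right_eq N (j + 1)
  calc N.choose (j + 2) * ((j + 1) * (j + 2))
      = N.choose (j + 1 + 1) * (j + 1 + 1) * (j + 1) := by ring
    _ = N.choose (j + 1) * (j + 1) * (N - (j + 1)) := by rw [e₂]; ring
    _ = N.choose j * ((N - j) * (N - (j + 1))) := by rw [e₁]; ring

/-- Log-concavity of `a_{2k} / (2k)!`, with denominators cleared and `m = 2k - 2`. -/
theorem zigzag_log_concave {m : ℕ} (hm : Even m) :
    (m + 1) * (m + 2) * (zigzag m * zigzag (m + 4)) ≤
      (m + 3) * (m + 4) * zigzag (m + 2) ^ 2 := by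
  have h := ncard_alternatingPairs_le hm
  rw [ncard_alternatingPairs, ncard_alternatingPairs,
    show m + 4 + m = m + 2 + (m + 2) by omega] at h
  have hc := choose_add_two_mul (m + 2 + (m + 2)) (m + 2)
  rw [Nat.add_sub_cancel, show m + 2 + (m + 2) - (m + 2 + 1) = m + 1 by omega] at hc
  have hpos : 0 < (m + 2 + (m + 2)).choose (m + 2) := Nat.choose_pos (by omega)
  refine Nat.le_of_mul_le_mul_left ?_ hpos
  calc (m + 2 + (m + 2)).choose (m + 2) * ((m + 1) * (m + 2) * (zigzag m * zigzag (m + 4)))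
      = (m + 2 + (m + 2)).choose (m + 2) * ((m + 2) * (m + 1)) *
          (zigzag m * zigzag (m + 4)) := by ring
    _ = (m + 3) * (m + 4) * ((m + 2 + (m + 2)).choose (m + 4) *
          (zigzag (m + 4) * zigzag m)) := by rw [← hc]; ring
    _ ≤ (m + 3) * (m + 4) * ((m + 2 + (m + 2)).choose (m + 2) *
          (zigzag (m + 2) * zigzag (m + 2))) := Nat.mul_le_mul_left _ h
    _ = _ := by ring

theorem choose_mul_zigzag_log_concave {N m : ℕ} (hm : Even m) (hN : m + 4 ≤ N) :
    (N.choose m * zigzag m) * (N.choose (m + 4) * zigzag (m + 4)) <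
      (N.choose (m + 2) * zigzag (m + 2)) ^ 2 := by
  obtain ⟨t, rfl⟩ := Nat.exists_eq_add_of_le hN
  have hz := zigzag_log_concave hm
  have c₁ := choose_add_two_mul (m + 4 + t) m
  have c₂ := choose_add_two_mul (m + 4 + t) (m + 2)
  rw [show m + 4 + t - m = t + 4 by omega, show m + 4 + t - (m + 1) = t + 3 by omega] at c₁
  rw [show m + 4 + t - (m + 2) = t + 2 by omega,
    show m + 4 + t - (m + 2 + 1) = t + 1 by omega] at c₂
  have hY : 0 < (m + 4 + t).choose (m + 2) := Nat.choose_pos (by omega)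
  have ha : 0 < zigzag (m + 2) := by
    obtain ⟨k, rfl⟩ := hm
    rw [show k + k + 2 = 2 * (k + 1) by ring]
    exact zigzag_two_mul_pos _
  generalize (m + 4 + t).choose (m + 2) = Y at *
  rw [show m + 2 + 2 = m + 4 by omega] at c₂
  generalize (m + 4 + t).choose m = X₁ at *
  generalize (m + 4 + t).choose (m + 4) = X₂ at *
  generalize zigzag m = b₁ at *
  generalize zigzag (m + 4) = b₂ at *
  generalize zigzag (m + 2) = a at *
  have hX : X₁ * X₂ * ((m + 3) * (m + 4) * ((t + 4) * (t + 3))) =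
      Y ^ 2 * ((m + 1) * (m + 2) * ((t + 2) * (t + 1))) := by
    calc _ = X₁ * ((t + 4) * (t + 3)) * (X₂ * ((m + 2 + 1) * (m + 4))) := by ring
      _ = _ := by rw [c₂, ← c₁]; ring
  refine lt_of_mul_lt_mul_right (a := (m + 3) * (m + 4) * ((t + 4) * (t + 3))) ?_ (Nat.zero_le _)
  calc X₁ * b₁ * (X₂ * b₂) * ((m + 3) * (m + 4) * ((t + 4) * (t + 3)))
      = X₁ * X₂ * ((m + 3) * (m + 4) * ((t + 4) * (t + 3))) * (b₁ * b₂) := by ring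
    _ = Y ^ 2 * ((t + 2) * (t + 1)) * ((m + 1) * (m + 2) * (b₁ * b₂)) := by rw [hX]; ring
    _ ≤ Y ^ 2 * ((t + 2) * (t + 1)) * ((m + 3) * (m + 4) * a ^ 2) := Nat.mul_le_mul_left _ hz
    _ = (Y * a) ^ 2 * ((m + 3) * (m + 4)) * ((t + 2) * (t + 1)) := by ring
    _ < (Y * a) ^ 2 * ((m + 3) * (m + 4)) * ((t + 4) * (t + 3)) :=
        Nat.mul_lt_mul_of_pos_left (by nlinarith) (by positivity)
    _ = _ := by ring

end BS

/-- For a fixed positive integer `n`, the sequence `β_k = C(n+1, 2k)·a_{2k}` of Betti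
numbers of the real permutohedral variety is log-concave: `β_k² ≥ β_{k-1}·β_{k+1}`,
and strictly so whenever `2k + 2 ≤ n + 1`. -/
theorem betti_permutohedral_log_concave (n : ℕ) (hn : 1 ≤ n) (k : ℕ) (hk : 1 ≤ k) :
    ((n + 1).choose (2 * k) * zigzag (2 * k)) ^ 2 ≥
      ((n + 1).choose (2 * (k - 1)) * zigzag (2 * (k - 1))) *
        ((n + 1).choose (2 * (k + 1)) * zigzag (2 * (k + 1))) ∧
    (2 * k + 2 ≤ n + 1 →
      ((n + 1).choose (2 * k) * zigzag (2 * k)) ^ 2 >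
        ((n + 1).choose (2 * (k - 1)) * zigzag (2 * (k - 1))) *
          ((n + 1).choose (2 * (k + 1)) * zigzag (2 * (k + 1)))) := by
  obtain ⟨j, rfl⟩ : ∃ j, k = j + 1 := ⟨k - 1, by omega⟩
  by_cases h : 2 * (j + 1) + 2 ≤ n + 1
  · have strict := BS.choose_mul_zigzag_log_concave (N := n + 1) (even_two_mul j) (by omega)
    exact ⟨strict.le, fun _ => strict⟩
  · refine ⟨?_, fun h' => absurd h' h⟩
    rw [Nat.choose_eq_zero_of_lt (show n + 1 < 2 * (j + 1 + 1) by omega)]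
    simp
end
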